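/- arXiv:0803.2719 — 2 statements merged into one kernel-verified Lean document; each statement's English description precedes it below -/
import Mathlib

section
/- Let F and G be summable ball kernels, let ψ be an ultrametric wavelet with ball J = B(c, p^{γ_J}) and φ an ultrametric wavelet with ball I = B(c, p^{γ_I}), with J a strict subset of I, and assume η_I ≠ 0 (η formed from the kernel G). Then for any a, b ∈ ℂ the function v(x, t) = a · exp(−η_J t + φ(x) Φ_{I,J} b η_I^{−1} (e^{−η_I t} − 1)) · ψ(x) + b e^{−η_I t} φ(x) satisfies the quadratic cascade equation for all x ∈ ℚ_p and all t > 0. -/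
open MeasureTheory

/-- The index (base-`p` logarithm of the radius) of the smallest ball of `ℚ_[p]`
containing the two points `x` and `y` (for `x ≠ y`): its radius is `‖x - y‖ = p ^ (-(x-y).valuation)`. -/
noncomputable def supIdx {p : ℕ} [Fact p.Prime] (x y : ℚ_[p]) : ℤ := -(x - y).valuation

/-- The index of the smallest ball containing the three points `x`, `ξ`, `η`
(for pairwise distinct points): its radius is `max (‖x-ξ‖, ‖x-η‖, ‖ξ-η‖)`. -/
noncomputable def sup3Idx {p : ℕ} [Fact p.Prime] (x ξ η : ℚ_[p]) : ℤ :=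
  max (supIdx x ξ) (max (supIdx x η) (supIdx ξ η))

/-- A ball kernel: a function on balls of `ℚ_[p]`, encoded as a function of a center and
an index (log_p of the radius), independent of the choice of center in the ball. -/
def IsBallKernel {p : ℕ} [Fact p.Prime] (F : ℚ_[p] → ℤ → ℂ) : Prop :=
  ∀ c c' : ℚ_[p], ∀ γ : ℤ, dist c c' ≤ (p : ℝ) ^ γ → F c γ = F c' γ

/-- Summability of a ball kernel: for every ball `B(c, p^γ₀)`,
`Σ_{γ > γ₀} ‖F(B(c, p^γ))‖ (p^γ - p^(γ-1)) < ∞`. -/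
def KernelSummable {p : ℕ} [Fact p.Prime] (F : ℚ_[p] → ℤ → ℂ) : Prop :=
  ∀ c : ℚ_[p], ∀ γ₀ : ℤ, Summable (fun n : ℕ =>
    ‖F c (γ₀ + 1 + n)‖ * ((p : ℝ) ^ (γ₀ + 1 + (n : ℤ)) - (p : ℝ) ^ (γ₀ + (n : ℤ))))

/-- An ultrametric wavelet with ball `B(c, p^γ)`: vanishes outside the ball, is constant
on each of the `p` maximal subballs (balls of radius `p^(γ-1)`), has zero mean, and is
not identically zero. -/
def IsWavelet {p : ℕ} [Fact p.Prime] [MeasurableSpace ℚ_[p]] (μ : Measure ℚ_[p])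
    (ψ : ℚ_[p] → ℂ) (c : ℚ_[p]) (γ : ℤ) : Prop :=
  (∀ x, (p : ℝ) ^ γ < dist x c → ψ x = 0) ∧
    (∀ x y, dist x y ≤ (p : ℝ) ^ (γ - 1) → ψ x = ψ y) ∧
    (∫ x, ψ x ∂μ) = 0 ∧ ψ ≠ 0

/-- The eigenvalue `λ_I = T(I) ν(I) + Σ_{J > I} T(J) (ν(J) - ν(J,I))` attached to the ball
`I = B(c, p^γI)` and the ball kernel `T`. -/
noncomputable def lamBall {p : ℕ} [Fact p.Prime] (T : ℚ_[p] → ℤ → ℂ) (c : ℚ_[p]) (γI : ℤ) : ℂ :=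
  T c γI * (((p : ℝ) ^ γI : ℝ) : ℂ) +
    ∑' n : ℕ, T c (γI + 1 + n) *
      (((p : ℝ) ^ (γI + 1 + (n : ℤ)) - (p : ℝ) ^ (γI + (n : ℤ)) : ℝ) : ℂ)

/-- The coefficient `Φ_{I,J}` for balls `J = B(c, p^γJ) ⊊ I = B(c, p^γI)`. -/
noncomputable def PhiIJ {p : ℕ} [Fact p.Prime] (F : ℚ_[p] → ℤ → ℂ) (c : ℚ_[p])
    (γI γJ : ℤ) : ℂ :=
  (((p : ℝ) ^ (2 * (γI - 1)) : ℝ) : ℂ) * F c γI - (((p : ℝ) ^ (2 * γJ) : ℝ) : ℂ) * F c γJ -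
    ∑ γ ∈ Finset.Ioo γJ γI, (((p : ℝ) ^ (2 * γ) - (p : ℝ) ^ (2 * γ - 2) : ℝ) : ℂ) * F c γ

/-- The (spatial) operator of the quadratic cascade equation:
`∫∫ F(sup(x,ξ,η)) f(ξ)(f(η) - f(x)) dμ(ξ) dμ(η) + ∫ G(sup(x,ξ))(f(x) - f(ξ)) dμ(ξ)`. -/
noncomputable def cascadeOp {p : ℕ} [Fact p.Prime] [MeasurableSpace ℚ_[p]]
    (μ : Measure ℚ_[p]) (F G : ℚ_[p] → ℤ → ℂ) (f : ℚ_[p] → ℂ) (x : ℚ_[p]) : ℂ :=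
  (∫ ξ, ∫ η, F x (sup3Idx x ξ η) * (f ξ * (f η - f x)) ∂μ ∂μ) +
    ∫ ξ, G x (supIdx x ξ) * (f x - f ξ) ∂μ

/-- `v` satisfies the quadratic cascade equation
`∂ₜ v(x,t) + ∫∫ F(sup(x,ξ,η)) v(ξ,t)(v(η,t) - v(x,t)) dμ(ξ) dμ(η)
  + ∫ G(sup(x,ξ))(v(x,t) - v(ξ,t)) dμ(ξ) = 0` for all `x ∈ ℚ_p` and all `t > 0`. -/
def SatisfiesCascade {p : ℕ} [Fact p.Prime] [MeasurableSpace ℚ_[p]]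
    (μ : Measure ℚ_[p]) (F G : ℚ_[p] → ℤ → ℂ) (v : ℚ_[p] → ℝ → ℂ) : Prop :=
  ∀ x : ℚ_[p], ∀ t : ℝ, 0 < t →
    HasDerivAt (fun s => v x s) (-(cascadeOp μ F G (fun y => v y t) x)) t

set_option linter.unusedSectionVars false

section Aux
variable {p : ℕ} [hp : Fact p.Prime]

lemma aux_p1 : (1 : ℝ) < p := by exact_mod_cast hp.out.one_lt
lemma aux_p0 : (0 : ℝ) < p := by exact_mod_cast hp.out.pos

lemma dist_eq_supIdx {x y : ℚ_[p]} (h : x ≠ y) : dist x y = (p : ℝ) ^ (supIdx x y) := by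
  rw [dist_eq_norm, Padic.norm_eq_zpow_neg_valuation (sub_ne_zero.2 h)]; rfl

lemma dist_le_iff_supIdx {x y : ℚ_[p]} (h : x ≠ y) (k : ℤ) :
    dist x y ≤ (p : ℝ) ^ k ↔ supIdx x y ≤ k := by
  rw [dist_eq_supIdx h]; exact zpow_le_zpow_iff_right₀ aux_p1

lemma dist_lt_iff_supIdx {x y : ℚ_[p]} (h : x ≠ y) (k : ℤ) :
    (p : ℝ) ^ k < dist x y ↔ k < supIdx x y := by
  rw [dist_eq_supIdx h]; exact zpow_lt_zpow_iff_right₀ aux_p1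

lemma aux_dist_trans {x y z : ℚ_[p]} {r : ℝ} (h1 : dist x y ≤ r) (h2 : dist y z ≤ r) :
    dist x z ≤ r := (dist_triangle_max x y z).trans (max_le h1 h2)

lemma sup3_eq {x ξ η : ℚ_[p]} (h1 : x ≠ ξ) (h2 : x ≠ η) (h3 : ξ ≠ η) :
    sup3Idx x ξ η = max (supIdx x ξ) (supIdx x η) := by
  have : supIdx ξ η ≤ max (supIdx x ξ) (supIdx x η) := by
    rw [← dist_le_iff_supIdx h3]
    apply aux_dist_trans (y := x)
    · rw [dist_comm, dist_le_iff_supIdx h1]; exact le_max_left _ _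
    · rw [dist_le_iff_supIdx h2]; exact le_max_right _ _
  unfold sup3Idx
  omega

variable [MeasurableSpace ℚ_[p]] [BorelSpace ℚ_[p]] (μ : Measure ℚ_[p]) [μ.IsAddHaarMeasure]

lemma aux_ball_center (x : ℚ_[p]) (r : ℝ) :
    μ (Metric.closedBall x r) = μ (Metric.closedBall 0 r) := by
  have := measure_preimage_add μ (-x) (Metric.closedBall (0 : ℚ_[p]) r)
  rw [← this]
  congr 1
  ext y
  simp [dist_eq_norm, sub_eq_neg_add]

lemma aux_ball_union (k : ℤ) : Metric.closedBall (0 : ℚ_[p]) ((p : ℝ) ^ (k + 1)) =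
    ⋃ i ∈ Finset.range p,
      Metric.closedBall ((i : ℚ_[p]) * (p : ℚ_[p]) ^ (-(k + 1))) ((p : ℝ) ^ k) := by
  have hp0 : (p : ℚ_[p]) ≠ 0 := by exact_mod_cast hp.out.ne_zero
  have hpr : (p : ℝ) ≠ 0 := aux_p0.ne'
  ext y
  simp only [Metric.mem_closedBall, Set.mem_iUnion, Finset.mem_range, exists_prop, dist_eq_norm,
    sub_zero]
  constructor
  · intro hy
    have hz : ‖y * (p : ℚ_[p]) ^ (k + 1)‖ ≤ 1 := by
      rw [norm_mul, Padic.norm_p_zpow]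
      calc _ ≤ (p : ℝ) ^ (k + 1) * (p : ℝ) ^ (-(k + 1)) := by gcongr
        _ = 1 := by rw [← zpow_add₀ hpr]; simp
    obtain ⟨z, hz'⟩ : ∃ z : ℤ_[p], (z : ℚ_[p]) = y * (p : ℚ_[p]) ^ (k + 1) := ⟨⟨_, hz⟩, rfl⟩
    obtain ⟨n, hn, hm⟩ := PadicInt.exists_mem_range z
    refine ⟨n, hn, ?_⟩
    rw [IsLocalRing.mem_maximalIdeal, PadicInt.mem_nonunits, PadicInt.norm_def, PadicInt.coe_sub,
      PadicInt.coe_natCast, hz'] at hm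
    have hm' : ‖y * (p : ℚ_[p]) ^ (k + 1) - n‖ < 1 := hm
    have e : y - (n : ℚ_[p]) * (p : ℚ_[p]) ^ (-(k + 1)) =
        (y * (p : ℚ_[p]) ^ (k + 1) - n) * (p : ℚ_[p]) ^ (-(k + 1)) := by
      rw [sub_mul, mul_assoc, ← zpow_add₀ hp0]; simp
    rw [Padic.norm_le_pow_iff_norm_lt_pow_add_one, e, norm_mul, Padic.norm_p_zpow, neg_neg]
    have : (0 : ℝ) < (p : ℝ) ^ (k + 1) := zpow_pos aux_p0 _
    nlinarith
  · rintro ⟨n, hn, h⟩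
    have e : y = (y - (n : ℚ_[p]) * (p : ℚ_[p]) ^ (-(k + 1))) +
       (n : ℚ_[p]) * (p : ℚ_[p]) ^ (-(k + 1)) := by ring
    rw [e]
    refine (Padic.nonarchimedean _ _).trans (max_le (h.trans ?_) ?_)
    · exact zpow_le_zpow_right₀ aux_p1.le (by omega)
    · rw [norm_mul, Padic.norm_p_zpow, neg_neg]
      have : ‖(n : ℚ_[p])‖ ≤ 1 := by simpa using Padic.norm_int_le_one (p := p) n
      have h2 : (0 : ℝ) < (p : ℝ) ^ (k + 1) := zpow_pos aux_p0 _
      nlinarith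

lemma aux_ball_step (k : ℤ) : μ (Metric.closedBall 0 ((p : ℝ) ^ (k + 1))) =
    p * μ (Metric.closedBall 0 ((p : ℝ) ^ k)) := by
  have hp0 : (p : ℚ_[p]) ≠ 0 := by exact_mod_cast hp.out.ne_zero
  rw [aux_ball_union, measure_biUnion_finset]
  · simp [aux_ball_center μ (_ * _)]
  · intro i hi j hj hij
    simp only [Finset.coe_range, Set.mem_Iio] at hi hj
    refine Set.disjoint_left.2 fun y h1 h2 => hij ?_
    simp only [Metric.mem_closedBall] at h1 h2
    rw [dist_comm] at h1
    have h := aux_dist_trans h1 h2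
    rw [dist_eq_norm, ← sub_mul, norm_mul, Padic.norm_p_zpow, neg_neg, zpow_add₀ aux_p0.ne',
      zpow_one] at h
    have h2 : (0 : ℝ) < (p : ℝ) ^ k := zpow_pos aux_p0 _
    have h4 : ‖(((i : ℤ) - (j : ℤ) : ℤ) : ℚ_[p])‖ < 1 := by
      push_cast
      have := aux_p1 (p := p)
      by_contra hc
      push Not at hc
      have h5 : (p : ℝ) ^ k < (p : ℝ) ^ k * p := by nlinarith
      nlinarith
    rw [Padic.norm_intCast_lt_one_iff] at h4
    have := Int.eq_zero_of_abs_lt_dvd h4 (by rw [abs_lt]; omega)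
    omega
  · intro i _
    exact Metric.isClosed_closedBall.measurableSet

lemma aux_ball (hμ : μ (Metric.closedBall 0 1) = 1) (x : ℚ_[p]) (k : ℤ) :
    μ.real (Metric.closedBall x ((p : ℝ) ^ k)) = (p : ℝ) ^ k := by
  have hs : ∀ k : ℤ, μ.real (Metric.closedBall 0 ((p : ℝ) ^ (k + 1))) =
      p * μ.real (Metric.closedBall 0 ((p : ℝ) ^ k)) := by
    intro k; simp [Measure.real, aux_ball_step μ k]
  have h0 : μ.real (Metric.closedBall x ((p : ℝ) ^ k)) =
      μ.real (Metric.closedBall 0 ((p : ℝ) ^ k)) := by simp [Measure.real, aux_ball_center μ x]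
  have hp0 := aux_p0 (p := p)
  rw [h0]
  induction k using Int.induction_on with
  | zero => simp [Measure.real, hμ]
  | succ i ih => rw [hs, ih (by simp [Measure.real, aux_ball_center μ x]), zpow_add₀ hp0.ne']; simp [mul_comm]
  | pred i ih =>
    have h := hs (-(i : ℤ) - 1)
    rw [sub_add_cancel, ih (by simp [Measure.real, aux_ball_center μ x])] at h
    have e : (p : ℝ) ^ (-(i : ℤ)) = p * (p : ℝ) ^ (-(i : ℤ) - 1) := by
      rw [zpow_sub₀ hp0.ne', zpow_one]; field_simp
    rw [e] at h
    exact (mul_left_cancel₀ hp0.ne' h).symm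

lemma aux_ae_ne (x : ℚ_[p]) : ∀ᵐ y ∂μ, x ≠ y := by
  have : ∀ᵐ y ∂μ, y ∉ ({x} : Set ℚ_[p]) := by
    exact measure_eq_zero_iff_ae_notMem.1 (measure_singleton x)
  filter_upwards [this] with y hy h using hy (by simp [h])

lemma aux_integrable {μ : Measure ℚ_[p]} [μ.IsAddHaarMeasure] {ψ : ℚ_[p] → ℂ} {c : ℚ_[p]} {γ : ℤ} (h : IsWavelet μ ψ c γ) : Integrable ψ μ := by
  apply Continuous.integrable_of_hasCompactSupport
  · rw [Metric.continuous_iff]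
    intro x ε hε
    refine ⟨(p : ℝ) ^ (γ - 1), zpow_pos aux_p0 _, fun y hy => ?_⟩
    rw [h.2.1 y x hy.le]; simpa using hε
  · apply HasCompactSupport.intro (isCompact_closedBall c ((p : ℝ) ^ γ))
    intro x hx
    exact h.1 x (by simpa using hx)

lemma aux_recenter {μ : Measure ℚ_[p]} {ψ : ℚ_[p] → ℂ} {c x : ℚ_[p]} {γ : ℤ} (h : IsWavelet μ ψ c γ)
    (hx : dist x c ≤ (p : ℝ) ^ γ) : IsWavelet μ ψ x γ := by
  refine ⟨fun y hy => h.1 y ?_, h.2⟩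
  by_contra hc
  push Not at hc
  rw [dist_comm] at hx
  exact absurd (aux_dist_trans hc hx) (not_le.2 hy)
 
lemma aux_far {c x η : ℚ_[p]} {γ : ℤ} (hx : (p : ℝ) ^ γ < dist x c)
    (hη : dist η c ≤ (p : ℝ) ^ γ) : supIdx x η = supIdx x c ∧ γ < supIdx x c := by
  have h0 : (0 : ℝ) < (p : ℝ) ^ γ := zpow_pos aux_p0 _
  have h1 : x ≠ c := by rintro rfl; simp at hx; linarith
  have h2 : x ≠ η := by rintro rfl; linarith
  have h3 := (dist_lt_iff_supIdx h1 γ).1 hx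
  refine ⟨?_, h3⟩
  apply le_antisymm
  · rw [← dist_le_iff_supIdx h2]
    apply aux_dist_trans (y := c) ((dist_le_iff_supIdx h1 _).2 le_rfl)
    rw [dist_comm]
    exact hη.trans (zpow_le_zpow_right₀ aux_p1.le h3.le)
  · by_contra hc
    push Not at hc
    have := (dist_le_iff_supIdx h2 (supIdx x c - 1)).2 (by omega)
    have h4 := aux_dist_trans this (hη.trans (zpow_le_zpow_right₀ aux_p1.le (by omega)))
    rw [dist_le_iff_supIdx h1] at h4
    omega

/-- shells -/
lemma aux_shell (hμ : μ (Metric.closedBall 0 1) = 1) {F : ℚ_[p] → ℤ → ℂ}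
    (hFs : KernelSummable F) (x : ℚ_[p]) (M : ℤ) :
    IntegrableOn (fun η => F x (supIdx x η)) (Metric.closedBall x ((p : ℝ) ^ M))ᶜ μ ∧
    ∫ η in (Metric.closedBall x ((p : ℝ) ^ M))ᶜ, F x (supIdx x η) ∂μ =
      ∑' n : ℕ, F x (M + 1 + n) *
      (((p : ℝ) ^ (M + 1 + (n : ℤ)) - (p : ℝ) ^ (M + (n : ℤ)) : ℝ) : ℂ) := by
  set S : ℕ → Set ℚ_[p] := fun n => Metric.closedBall x ((p : ℝ) ^ (M + 1 + (n : ℤ))) \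
    Metric.closedBall x ((p : ℝ) ^ (M + (n : ℤ))) with hS
  have hfin : ∀ r, μ (Metric.closedBall x r) < ⊤ := fun r => measure_closedBall_lt_top
  have hmem : ∀ n y, y ∈ S n ↔ x ≠ y ∧ supIdx x y = M + 1 + n := by
    intro n y
    simp only [hS, Set.mem_sdiff, Metric.mem_closedBall]
    by_cases h : x = y
    · subst h
      simp [zpow_nonneg (aux_p0 (p := p)).le]
    · rw [dist_comm, dist_le_iff_supIdx h, dist_le_iff_supIdx h]
      simp only [ne_eq, h, not_false_eq_true, true_and]
      omega
  have hU : (Metric.closedBall x ((p : ℝ) ^ M))ᶜ = ⋃ n, S n := by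
    ext y
    simp only [Set.mem_iUnion, hmem, Set.mem_compl_iff, Metric.mem_closedBall]
    by_cases h : x = y
    · subst h
      simp [zpow_nonneg (aux_p0 (p := p)).le]
    · rw [dist_comm, dist_le_iff_supIdx h]
      simp only [ne_eq, h, not_false_eq_true, true_and]
      constructor
      · intro h; exact ⟨(supIdx x y - (M + 1)).toNat, by omega⟩
      · rintro ⟨n, hn⟩; omega
  have hmeas : ∀ n, MeasurableSet (S n) := fun n =>
    Metric.isClosed_closedBall.measurableSet.diff Metric.isClosed_closedBall.measurableSet
  have hvol : ∀ n, μ.real (S n) = (p : ℝ) ^ (M + 1 + (n : ℤ)) - (p : ℝ) ^ (M + (n : ℤ)) := by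
    intro n
    rw [hS, measureReal_sdiff ?_ Metric.isClosed_closedBall.measurableSet (hfin _).ne, aux_ball μ hμ,
      aux_ball μ hμ]
    exact Metric.closedBall_subset_closedBall (zpow_le_zpow_right₀ aux_p1.le (by omega))
  have hSfin : ∀ n, μ (S n) ≠ ⊤ := fun n =>
    ((measure_mono Set.sdiff_subset).trans_lt (hfin _)).ne
  have hi : ∀ n, IntegrableOn (fun η => F x (supIdx x η)) (S n) μ := by
    intro n
    refine IntegrableOn.congr_fun (f := fun _ => F x (M + 1 + n)) ?_ ?_ (hmeas n)
    · exact integrableOn_const (hSfin n)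
    · intro y hy; simp only [((hmem n y).1 hy).2]
  have hint : IntegrableOn (fun η => F x (supIdx x η)) (⋃ n, S n) μ := by
    apply integrableOn_iUnion_of_summable_integral_norm hi
    convert hFs x M using 2 with n
    rw [setIntegral_congr_fun (g := fun _ => ‖F x (M + 1 + n)‖) (hmeas n)]
    · rw [setIntegral_const, hvol, smul_eq_mul, mul_comm]
    · intro y hy; simp only [((hmem n y).1 hy).2]
  rw [hU]
  refine ⟨hint, ?_⟩
  rw [← (hasSum_integral_iUnion hmeas ?_ hint).tsum_eq]
  · congr 1; ext n
    rw [setIntegral_congr_fun (g := fun _ => F x (M + 1 + n)) (hmeas n)]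
    · rw [setIntegral_const, hvol, Complex.real_smul, mul_comm]
    · intro y hy; simp only [((hmem n y).1 hy).2]
  · intro i j hij
    refine Set.disjoint_left.2 fun y h1 h2 => hij ?_
    have := ((hmem _ _).1 h1).2
    have := ((hmem _ _).1 h2).2
    omega

/-- inner integral -/
lemma aux_inner (hμ : μ (Metric.closedBall 0 1) = 1) {F : ℚ_[p] → ℤ → ℂ}
    (hFs : KernelSummable F) {ψ : ℚ_[p] → ℂ} {c : ℚ_[p]} {γ : ℤ} (h : IsWavelet μ ψ c γ)
    (x : ℚ_[p]) (m : ℤ) :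
    Integrable (fun η => F x (max m (supIdx x η)) * (ψ η - ψ x)) μ ∧
    ∫ η, F x (max m (supIdx x η)) * (ψ η - ψ x) ∂μ = - ψ x * lamBall F x (max m γ) := by
  have hψi := aux_integrable h
  by_cases hx : dist x c ≤ (p : ℝ) ^ γ
  swap
  · push Not at hx
    have hx0 := h.1 x hx
    have e : (fun η => F x (max m (supIdx x η)) * (ψ η - ψ x)) =
        fun η => F x (max m (supIdx x c)) * ψ η := by
      ext η
      rw [hx0, sub_zero]
      by_cases hη : dist η c ≤ (p : ℝ) ^ γ
      · rw [(aux_far hx hη).1]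
      · rw [h.1 η (not_le.1 hη)]; simp
    rw [e, integral_const_mul, h.2.2.1, hx0]
    exact ⟨hψi.const_mul _, by simp⟩
  · replace h := aux_recenter h hx
    set M := max m γ with hM
    set B := Metric.closedBall x ((p : ℝ) ^ M) with hB
    have hBm : MeasurableSet B := Metric.isClosed_closedBall.measurableSet
    obtain ⟨s1, s2⟩ := aux_shell μ hμ hFs x M
    have hsub : ∀ η ∉ B, x ≠ η ∧ M < supIdx x η ∧ ψ η = 0 := by
      intro η hη
      simp only [hB, Metric.mem_closedBall, not_le] at hη
      have h1 : x ≠ η := by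
        rintro rfl
        simp only [dist_self] at hη
        exact absurd hη (not_lt.2 (zpow_nonneg aux_p0.le _))
      refine ⟨h1, ?_, h.1 η (lt_of_le_of_lt (zpow_le_zpow_right₀ aux_p1.le (le_max_right _ _)) hη)⟩
      rw [dist_comm, dist_lt_iff_supIdx h1] at hη
      exact hη
    have e1 : Set.EqOn (fun η => F x M * (ψ η - ψ x))
        (fun η => F x (max m (supIdx x η)) * (ψ η - ψ x)) B := by
      intro η hη
      simp only
      by_cases hd : dist x η ≤ (p : ℝ) ^ (γ - 1)
      · rw [h.2.1 x η hd]; simp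
      · have h1 : x ≠ η := by
          rintro rfl
          simp only [dist_self, not_le] at hd
          exact absurd hd (not_lt.2 (zpow_nonneg aux_p0.le _))
        simp only [hB, Metric.mem_closedBall] at hη
        rw [dist_comm] at hη
        rw [dist_le_iff_supIdx h1] at hd hη
        congr 2
        omega
    have e2 : Set.EqOn (fun η => F x (supIdx x η) * (- ψ x))
        (fun η => F x (max m (supIdx x η)) * (ψ η - ψ x)) Bᶜ := by
      intro η hη
      obtain ⟨_, h2, h3⟩ := hsub η hη
      simp only [h3, zero_sub]
      congr 2
      omega
    have hfin : μ B ≠ ⊤ := measure_closedBall_lt_top.ne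
    have i0 : IntegrableOn (fun η => ψ η - ψ x) B μ :=
      hψi.integrableOn.sub (integrableOn_const hfin)
    have i1 := IntegrableOn.congr_fun (i0.const_mul (F x M)) e1 hBm
    have i2 := IntegrableOn.congr_fun (s1.mul_const (- ψ x)) e2 hBm.compl
    have hI : Integrable (fun η => F x (max m (supIdx x η)) * (ψ η - ψ x)) μ := by
      rw [← integrableOn_univ, ← Set.union_compl_self B]
      exact i1.union i2
    refine ⟨hI, ?_⟩
    have z : ∫ η in B, ψ η ∂μ = 0 := by
      rw [setIntegral_eq_integral_of_forall_compl_eq_zero (fun y hy => (hsub y hy).2.2), h.2.2.1]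
    rw [← integral_add_compl hBm hI, ← setIntegral_congr_fun hBm e1,
      ← setIntegral_congr_fun hBm.compl e2, integral_const_mul, integral_mul_const, s2,
      integral_sub hψi.integrableOn (integrableOn_const hfin), z, setIntegral_const,
      aux_ball μ hμ, Complex.real_smul, lamBall]
    ring

lemma aux_zero {ψ : ℚ_[p] → ℂ} {c : ℚ_[p]} {γ : ℤ} (h : IsWavelet μ ψ c γ)
    (x : ℚ_[p]) (m : ℤ) (hm : γ ≤ m) (L : ℤ → ℂ) :
    Integrable (fun ξ => ψ ξ * L (max (supIdx x ξ) m)) μ ∧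
    ∫ ξ, ψ ξ * L (max (supIdx x ξ) m) ∂μ = 0 := by
  have hψi := aux_integrable h
  obtain ⟨C, e⟩ : ∃ C : ℂ, (fun ξ => ψ ξ * C) =ᵐ[μ] (fun ξ => ψ ξ * L (max (supIdx x ξ) m)) := by
    by_cases hx : dist x c ≤ (p : ℝ) ^ γ
    · replace h := aux_recenter h hx
      refine ⟨L m, ?_⟩
      filter_upwards [aux_ae_ne μ x] with ξ hξ
      by_cases hd : dist ξ x ≤ (p : ℝ) ^ γ
      · rw [dist_comm, dist_le_iff_supIdx hξ] at hd
        congr 2; omega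
      · rw [h.1 ξ (not_le.1 hd)]; simp
    · push Not at hx
      refine ⟨L (max (supIdx x c) m), Filter.Eventually.of_forall fun ξ => ?_⟩
      simp only
      by_cases hη : dist ξ c ≤ (p : ℝ) ^ γ
      · rw [(aux_far hx hη).1]
      · rw [h.1 ξ (not_le.1 hη)]; simp
  exact ⟨(hψi.mul_const C).congr e, by rw [← integral_congr_ae e, integral_mul_const, h.2.2.1, zero_mul]⟩

lemma aux_lam_step {F : ℚ_[p] → ℤ → ℂ} (hFs : KernelSummable F) (x : ℚ_[p]) (k : ℤ) :
    lamBall F x k = lamBall F x (k + 1) + (((p : ℝ) ^ k : ℝ) : ℂ) * (F x k - F x (k + 1)) := by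
  have hs : Summable (fun n : ℕ => F x (k + 1 + n) *
      (((p : ℝ) ^ (k + 1 + (n : ℤ)) - (p : ℝ) ^ (k + (n : ℤ)) : ℝ) : ℂ)) := by
    apply Summable.of_norm
    convert hFs x k using 2 with n
    rw [norm_mul, Complex.norm_real, Real.norm_of_nonneg]
    exact sub_nonneg.2 (zpow_le_zpow_right₀ aux_p1.le (by omega))
  unfold lamBall
  rw [hs.tsum_eq_zero_add]
  have e : ∀ n : ℕ, F x (k + 1 + ((n + 1 : ℕ) : ℤ)) * (((p : ℝ) ^ (k + 1 + ((n + 1 : ℕ) : ℤ)) -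
      (p : ℝ) ^ (k + ((n + 1 : ℕ) : ℤ)) : ℝ) : ℂ) = F x (k + 1 + 1 + n) *
      (((p : ℝ) ^ (k + 1 + 1 + (n : ℤ)) - (p : ℝ) ^ (k + 1 + (n : ℤ)) : ℝ) : ℂ) := by
    intro n
    push_cast
    rw [show k + 1 + ((n : ℤ) + 1) = k + 1 + 1 + n by ring,
      show k + ((n : ℤ) + 1) = k + 1 + n by ring]
  simp only [e]
  push_cast
  simp only [add_zero]
  ring

lemma aux_Phi_step (F : ℚ_[p] → ℤ → ℂ) (x : ℚ_[p]) (i k : ℤ) (hk : k + 1 < i) :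
    PhiIJ F x i k = PhiIJ F x i (k + 1) -
      (((p : ℝ) ^ k : ℝ) : ℂ) * (((p : ℝ) ^ k : ℝ) : ℂ) * (F x k - F x (k + 1)) := by
  have hp0 : (p : ℂ) ≠ 0 := by exact_mod_cast (Fact.out : p.Prime).ne_zero
  unfold PhiIJ
  have : Finset.Ioo k i = insert (k + 1) (Finset.Ioo (k + 1) i) := by
    ext j; simp only [Finset.mem_Ioo, Finset.mem_insert]; omega
  rw [this, Finset.sum_insert (by simp), show 2 * (k + 1) - 2 = 2 * k by ring,
    show 2 * k = k + k by ring]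
  push_cast
  rw [zpow_add₀ hp0 k k]
  ring

lemma aux_Phi_base (F : ℚ_[p] → ℤ → ℂ) (x : ℚ_[p]) (k : ℤ) :
    PhiIJ F x (k + 1) k = -
      ((((p : ℝ) ^ k : ℝ) : ℂ) * (((p : ℝ) ^ k : ℝ) : ℂ) * (F x k - F x (k + 1))) := by
  have hp0 : (p : ℂ) ≠ 0 := by exact_mod_cast (Fact.out : p.Prime).ne_zero
  unfold PhiIJ
  have : Finset.Ioo k (k + 1) = ∅ := by
    ext j; simp only [Finset.mem_Ioo, Finset.notMem_empty, iff_false]; omega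
  rw [this, Finset.sum_empty, add_sub_cancel_right, show 2 * k = k + k by ring]
  push_cast
  rw [zpow_add₀ hp0 k k]
  ring

lemma aux_cross_step (hμ : μ (Metric.closedBall 0 1) = 1) {F : ℚ_[p] → ℤ → ℂ}
    (hFs : KernelSummable F) {φ : ℚ_[p] → ℂ} {x : ℚ_[p]} {γ : ℤ} (h : IsWavelet μ φ x γ)
    (k : ℤ) (hk : k < γ) (V : ℂ)
    (ih : Integrable (fun ξ => φ ξ * lamBall F x (max (supIdx x ξ) (k + 1))) μ ∧
      ∫ ξ, φ ξ * lamBall F x (max (supIdx x ξ) (k + 1)) ∂μ = V) :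
    Integrable (fun ξ => φ ξ * lamBall F x (max (supIdx x ξ) k)) μ ∧
      ∫ ξ, φ ξ * lamBall F x (max (supIdx x ξ) k) ∂μ = V + φ x *
      ((((p : ℝ) ^ k : ℝ) : ℂ) * (((p : ℝ) ^ k : ℝ) : ℂ) * (F x k - F x (k + 1))) := by
  set d := (((p : ℝ) ^ k : ℝ) : ℂ) * (F x k - F x (k + 1)) with hd
  set B := Metric.closedBall x ((p : ℝ) ^ k) with hB
  have hBm : MeasurableSet B := Metric.isClosed_closedBall.measurableSet
  have hfin : μ B ≠ ⊤ := measure_closedBall_lt_top.ne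
  have e : (fun ξ => φ ξ * lamBall F x (max (supIdx x ξ) (k + 1)) +
      B.indicator (fun _ => φ x * d) ξ) =ᵐ[μ] fun ξ => φ ξ * lamBall F x (max (supIdx x ξ) k) := by
    filter_upwards [aux_ae_ne μ x] with ξ hξ
    have hmem : ξ ∈ B ↔ supIdx x ξ ≤ k := by
      rw [hB, Metric.mem_closedBall, dist_comm, dist_le_iff_supIdx hξ]
    by_cases hm : supIdx x ξ ≤ k
    · rw [Set.indicator_of_mem (hmem.2 hm), max_eq_right hm, max_eq_right (by omega),
        aux_lam_step hFs x k, h.2.1 x ξ]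
      · ring
      · rw [dist_le_iff_supIdx hξ]; omega
    · rw [Set.indicator_of_notMem (fun hc => hm (hmem.1 hc)), max_eq_left (by omega),
        max_eq_left (by omega), add_zero]
  have hi : Integrable (B.indicator (fun _ => φ x * d)) μ :=
    (integrable_indicator_iff hBm).2 (integrableOn_const hfin)
  refine ⟨(ih.1.add hi).congr e, ?_⟩
  rw [← integral_congr_ae e, integral_add ih.1 hi, ih.2, integral_indicator hBm,
    setIntegral_const, aux_ball μ hμ, Complex.real_smul, hd]
  ring

lemma aux_cross (hμ : μ (Metric.closedBall 0 1) = 1) {F : ℚ_[p] → ℤ → ℂ}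
    (hFs : KernelSummable F) {φ : ℚ_[p] → ℂ} {x : ℚ_[p]} {γ : ℤ} (h : IsWavelet μ φ x γ)
    (n : ℕ) :
    Integrable (fun ξ => φ ξ * lamBall F x (max (supIdx x ξ) (γ - 1 - n))) μ ∧
      ∫ ξ, φ ξ * lamBall F x (max (supIdx x ξ) (γ - 1 - n)) ∂μ =
        - (φ x * PhiIJ F x γ (γ - 1 - n)) := by
  induction n with
  | zero =>
    have h0 := aux_zero μ h x γ le_rfl (lamBall F x)
    have := aux_cross_step μ hμ hFs h (γ - 1) (by omega) 0 (by simpa using h0)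
    have h2 := aux_Phi_base F x (γ - 1)
    rw [sub_add_cancel] at h2
    simp only [Nat.cast_zero, sub_zero]
    refine ⟨this.1, ?_⟩
    rw [this.2, h2, sub_add_cancel]
    ring
  | succ n ih =>
    have ek : γ - 1 - ((n + 1 : ℕ) : ℤ) + 1 = γ - 1 - n := by push_cast; ring
    have := aux_cross_step μ hμ hFs h (γ - 1 - ((n + 1 : ℕ) : ℤ)) (by omega) _ (by rw [ek]; exact ih)
    refine ⟨this.1, ?_⟩
    rw [this.2, aux_Phi_step F x γ (γ - 1 - ((n + 1 : ℕ) : ℤ)) (by omega), ek]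
    ring

lemma aux_F_eq {F : ℚ_[p] → ℤ → ℂ} (hF : IsBallKernel F) {x c : ℚ_[p]} {γ : ℤ}
    (h : dist x c ≤ (p : ℝ) ^ γ) (k : ℤ) (hk : γ ≤ k) : F x k = F c k :=
  hF x c k (h.trans (zpow_le_zpow_right₀ aux_p1.le hk))

lemma aux_lam_eq {F : ℚ_[p] → ℤ → ℂ} (hF : IsBallKernel F) {x c : ℚ_[p]} {γ : ℤ}
    (h : dist x c ≤ (p : ℝ) ^ γ) : lamBall F x γ = lamBall F c γ := by
  unfold lamBall
  rw [aux_F_eq hF h _ le_rfl]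
  congr 2; ext n
  rw [aux_F_eq hF h _ (by omega)]

lemma aux_Phi_eq {F : ℚ_[p] → ℤ → ℂ} (hF : IsBallKernel F) {x c : ℚ_[p]} {i j : ℤ}
    (h : dist x c ≤ (p : ℝ) ^ j) (hij : j < i) : PhiIJ F x i j = PhiIJ F c i j := by
  unfold PhiIJ
  rw [aux_F_eq hF h _ le_rfl, aux_F_eq hF h _ hij.le]
  congr 1
  apply Finset.sum_congr rfl
  intro k hk
  rw [aux_F_eq hF h _ (Finset.mem_Ioo.1 hk).1.le]

lemma aux_cross' (hμ : μ (Metric.closedBall 0 1) = 1) {F : ℚ_[p] → ℤ → ℂ} (hF : IsBallKernel F)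
    (hFs : KernelSummable F) {ψ φ : ℚ_[p] → ℂ} {c : ℚ_[p]} {γJ γI : ℤ} (hγ : γJ < γI)
    (hψ : IsWavelet μ ψ c γJ) (hφ : IsWavelet μ φ c γI) (x : ℚ_[p]) :
    Integrable (fun ξ => ψ x * (φ ξ * lamBall F x (max (supIdx x ξ) γJ))) μ ∧
      ∫ ξ, ψ x * (φ ξ * lamBall F x (max (supIdx x ξ) γJ)) ∂μ =
        - (ψ x * (φ c * PhiIJ F c γI γJ)) := by
  by_cases hx : dist x c ≤ (p : ℝ) ^ γJ
  · have hx' : dist x c ≤ (p : ℝ) ^ (γI - 1) :=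
      hx.trans (zpow_le_zpow_right₀ aux_p1.le (by omega))
    have hx'' : dist x c ≤ (p : ℝ) ^ γI :=
      hx.trans (zpow_le_zpow_right₀ aux_p1.le (by omega))
    have := aux_cross μ hμ hFs (aux_recenter hφ hx'') (γI - 1 - γJ).toNat
    rw [show γI - 1 - ((γI - 1 - γJ).toNat : ℤ) = γJ by omega] at this
    refine ⟨this.1.const_mul _, ?_⟩
    rw [integral_const_mul, this.2, aux_Phi_eq hF hx hγ, hφ.2.1 x c hx']
    ring
  · rw [hψ.1 x (not_le.1 hx)]; simp

lemma aux_G (hμ : μ (Metric.closedBall 0 1) = 1) {G : ℚ_[p] → ℤ → ℂ} (hG : IsBallKernel G)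
    (hGs : KernelSummable G) {ψ : ℚ_[p] → ℂ} {c : ℚ_[p]} {γ : ℤ} (h : IsWavelet μ ψ c γ)
    (x : ℚ_[p]) :
    Integrable (fun ξ => G x (supIdx x ξ) * (ψ x - ψ ξ)) μ ∧
    ∫ ξ, G x (supIdx x ξ) * (ψ x - ψ ξ) ∂μ = ψ x * lamBall G c γ := by
  obtain ⟨h1, h2⟩ := aux_inner μ hμ hGs h x γ
  have e : (fun ξ => G x (supIdx x ξ) * (ψ x - ψ ξ)) =
      fun ξ => - (G x (max γ (supIdx x ξ)) * (ψ ξ - ψ x)) := by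
    ext ξ
    by_cases hm : γ ≤ supIdx x ξ
    · rw [max_eq_right hm]; ring
    · have : ψ ξ = ψ x := by
        by_cases hξ : x = ξ
        · rw [hξ]
        · symm; apply h.2.1; rw [dist_le_iff_supIdx hξ]; omega
      rw [this]; simp
  rw [e, integral_neg, h2, max_self]
  refine ⟨h1.neg, ?_⟩
  by_cases hx : dist x c ≤ (p : ℝ) ^ γ
  · rw [aux_lam_eq hG hx]; ring
  · rw [h.1 x (not_le.1 hx)]; simp

lemma aux_op (hμ : μ (Metric.closedBall 0 1) = 1)
    (F G : ℚ_[p] → ℤ → ℂ) (hF : IsBallKernel F) (hG : IsBallKernel G)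
    (hFs : KernelSummable F) (hGs : KernelSummable G)
    (ψ φ : ℚ_[p] → ℂ) (c : ℚ_[p]) (γJ γI : ℤ) (hγ : γJ < γI)
    (hψ : IsWavelet μ ψ c γJ) (hφ : IsWavelet μ φ c γI) (A B : ℂ) (x : ℚ_[p]) :
    cascadeOp μ F G (fun y => A * ψ y + B * φ y) x =
      lamBall G c γJ * A * ψ x + lamBall G c γI * B * φ x +
        A * B * φ c * PhiIJ F c γI γJ * ψ x := by
  unfold cascadeOp
  have gψ := aux_G μ hμ hG hGs hψ x
  have gφ := aux_G μ hμ hG hGs hφ x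
  have hGI : ∫ ξ, G x (supIdx x ξ) * (A * ψ x + B * φ x - (A * ψ ξ + B * φ ξ)) ∂μ =
      A * (ψ x * lamBall G c γJ) + B * (φ x * lamBall G c γI) := by
    rw [← gψ.2, ← gφ.2, ← integral_const_mul, ← integral_const_mul,
      ← integral_add (gψ.1.const_mul A) (gφ.1.const_mul B)]
    congr 1; ext ξ; ring
  have hin : ∀ᵐ ξ ∂μ, ∫ η, F x (sup3Idx x ξ η) *
      ((A * ψ ξ + B * φ ξ) * (A * ψ η + B * φ η - (A * ψ x + B * φ x))) ∂μ =
      (A * ψ ξ + B * φ ξ) * (A * (-ψ x * lamBall F x (max (supIdx x ξ) γJ)) +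
        B * (-φ x * lamBall F x (max (supIdx x ξ) γI))) := by
    filter_upwards [aux_ae_ne μ x] with ξ hξ
    have iψ := aux_inner μ hμ hFs hψ x (supIdx x ξ)
    have iφ := aux_inner μ hμ hFs hφ x (supIdx x ξ)
    rw [← iψ.2, ← iφ.2, ← integral_const_mul, ← integral_const_mul,
      ← integral_add (iψ.1.const_mul A) (iφ.1.const_mul B), ← integral_const_mul]
    apply integral_congr_ae
    filter_upwards [aux_ae_ne μ x, aux_ae_ne μ ξ] with η h1 h2
    rw [sup3_eq hξ h1 h2]
    ring
  rw [integral_congr_ae hin, hGI]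
  have z1 := aux_zero μ hψ x γJ le_rfl (lamBall F x)
  have z2 := aux_zero μ hψ x γI hγ.le (lamBall F x)
  have z3 := aux_zero μ hφ x γI le_rfl (lamBall F x)
  have z4 := aux_cross' μ hμ hF hFs hγ hψ hφ x
  have e : ∀ ξ, (A * ψ ξ + B * φ ξ) * (A * (-ψ x * lamBall F x (max (supIdx x ξ) γJ)) +
        B * (-φ x * lamBall F x (max (supIdx x ξ) γI))) =
      (-(A * A * ψ x)) * (ψ ξ * lamBall F x (max (supIdx x ξ) γJ)) +
      (-(A * B * φ x)) * (ψ ξ * lamBall F x (max (supIdx x ξ) γI)) +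
      (-(B * B * φ x)) * (φ ξ * lamBall F x (max (supIdx x ξ) γI)) +
      (-(A * B)) * (ψ x * (φ ξ * lamBall F x (max (supIdx x ξ) γJ))) := by
    intro ξ; ring
  simp only [e]
  have i1 := z1.1.const_mul (-(A * A * ψ x))
  have i2 := z2.1.const_mul (-(A * B * φ x))
  have i3 := z3.1.const_mul (-(B * B * φ x))
  have i4 := z4.1.const_mul (-(A * B))
  have i12 := i1.add i2
  have i123 := i12.add i3
  simp only [Pi.add_def] at i12 i123
  rw [integral_add i123 i4, integral_add i12 i3, integral_add i1 i2,
    integral_const_mul, integral_const_mul, integral_const_mul, integral_const_mul,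
    z1.2, z2.2, z3.2, z4.2]
  ring

end Aux

/-- For summable ball kernels `F`, `G`, wavelets `ψ` with ball
`J = B(c, p^γJ)` and `φ` with ball `I = B(c, p^γI)`, `J ⊊ I` (i.e. `γJ < γI`), and
`η_I ≠ 0`, the function
`v(x,t) = a exp(-η_J t + φ(x) Φ_{I,J} b η_I⁻¹ (e^(-η_I t) - 1)) ψ(x) + b e^(-η_I t) φ(x)`
satisfies the quadratic cascade equation for all `x` and all `t > 0`. -/
theorem two_wavelet_solution_nested {p : ℕ} [Fact p.Prime]
    [MeasurableSpace ℚ_[p]] [BorelSpace ℚ_[p]]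
    (μ : Measure ℚ_[p]) [μ.IsAddHaarMeasure] (hμ : μ (Metric.closedBall 0 1) = 1)
    (F G : ℚ_[p] → ℤ → ℂ) (hF : IsBallKernel F) (hG : IsBallKernel G)
    (hFs : KernelSummable F) (hGs : KernelSummable G)
    (ψ φ : ℚ_[p] → ℂ) (c : ℚ_[p]) (γJ γI : ℤ) (hγ : γJ < γI)
    (hψ : IsWavelet μ ψ c γJ) (hφ : IsWavelet μ φ c γI)
    (hη : lamBall G c γI ≠ 0) (a b : ℂ) :
    SatisfiesCascade μ F G
      (fun x t => a * Complex.exp (-(lamBall G c γJ) * (t : ℂ) +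
          φ x * PhiIJ F c γI γJ * b * (lamBall G c γI)⁻¹ *
            (Complex.exp (-(lamBall G c γI) * (t : ℂ)) - 1)) * ψ x +
        b * Complex.exp (-(lamBall G c γI) * (t : ℂ)) * φ x) := by
  intro x t _
  have hc : ∀ (y : ℚ_[p]) (E : ℂ → ℂ), E (φ y) * ψ y = E (φ c) * ψ y := by
    intro y E
    by_cases hy : dist y c ≤ (p : ℝ) ^ γJ
    · rw [hφ.2.1 y c (hy.trans (zpow_le_zpow_right₀ aux_p1.le (by omega)))]
    · rw [hψ.1 y (not_le.1 hy)]; simp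
  set ηJ := lamBall G c γJ
  set ηI := lamBall G c γI
  set P := PhiIJ F c γI γJ with hP
  have key : ∀ (y : ℚ_[p]) (s : ℝ), a * Complex.exp (-ηJ * (s : ℂ) +
          φ y * P * b * ηI⁻¹ * (Complex.exp (-ηI * (s : ℂ)) - 1)) * ψ y +
        b * Complex.exp (-ηI * (s : ℂ)) * φ y =
      (a * Complex.exp (-ηJ * (s : ℂ) +
          φ c * P * b * ηI⁻¹ * (Complex.exp (-ηI * (s : ℂ)) - 1))) * ψ y +
        (b * Complex.exp (-ηI * (s : ℂ))) * φ y := fun y s => by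
    rw [hc y (fun z => a * Complex.exp (-ηJ * (s : ℂ) +
          z * P * b * ηI⁻¹ * (Complex.exp (-ηI * (s : ℂ)) - 1)))]
  simp only [key]
  rw [aux_op μ hμ F G hF hG hFs hGs ψ φ c γJ γI hγ hψ hφ]
  have d0 : HasDerivAt (fun s : ℝ => (s : ℂ)) 1 t := Complex.ofRealCLM.hasDerivAt
  have d1 : HasDerivAt (fun s : ℝ => Complex.exp (-ηI * (s : ℂ)))
      (Complex.exp (-ηI * (t : ℂ)) * (-ηI * 1)) t := (d0.const_mul (-ηI)).cexp
  have d2 : HasDerivAt (fun s : ℝ => -ηJ * (s : ℂ) +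
      φ c * P * b * ηI⁻¹ * (Complex.exp (-ηI * (s : ℂ)) - 1))
      (-ηJ * 1 + φ c * P * b * ηI⁻¹ * (Complex.exp (-ηI * (t : ℂ)) * (-ηI * 1))) t :=
    (d0.const_mul (-ηJ)).add ((d1.sub_const 1).const_mul _)
  have d3 := ((d2.cexp.const_mul a).mul_const (ψ x)).add ((d1.const_mul b).mul_const (φ x))
  refine d3.congr_deriv ?_
  have e : ηI⁻¹ * ηI = 1 := inv_mul_cancel₀ hη
  linear_combination (-(a * Complex.exp (-ηJ * (t : ℂ) +
      φ c * P * b * ηI⁻¹ * (Complex.exp (-ηI * (t : ℂ)) - 1)) * φ c * P * b *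
      Complex.exp (-ηI * (t : ℂ)) * ψ x)) * e
end

section
/- Let ψ_1, …, ψ_n be ultrametric wavelets with balls B_1, …, B_n, let F and G be summable ball kernels, and let c_1, …, c_n : [0, ∞) → ℂ be continuously differentiable functions such that for each k and all t ≥ 0: c_k′(t) = − c_k(t) [ η_{B_k} + Σ_{j : B_k ⊊ B_j} c_j(t) ψ_j(x_k) Φ_{B_j, B_k} ], where x_k is any point of B_k (whenever B_k ⊊ B_j the wavelet ψ_j is constant on B_k, so the value ψ_j(x_k) does not depend on the choice of x_k), η is formed from the kernel G and Φ from the kernel F. Then v(x, t) = Σ_{k=1}^n c_k(t) ψ_k(x) satisfies the quadratic cascade equation for all x ∈ ℚ_p and all t > 0. -/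
open MeasureTheory

open scoped Classical

namespace Cascade

open Metric

variable {p : ℕ} [hp : Fact p.Prime]

lemma p_pos : (0 : ℝ) < p := by exact_mod_cast hp.out.pos

lemma one_lt_p : (1 : ℝ) < p := by exact_mod_cast hp.out.one_lt

lemma dist_eq_zpow {x y : ℚ_[p]} (h : x ≠ y) : dist x y = (p : ℝ) ^ supIdx x y := by
  rw [dist_eq_norm, supIdx]
  exact Padic.norm_eq_zpow_neg_valuation (sub_ne_zero.2 h)

lemma supIdx_le_iff {x y : ℚ_[p]} (h : x ≠ y) (k : ℤ) :
    supIdx x y ≤ k ↔ dist x y ≤ (p : ℝ) ^ k := by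
  rw [dist_eq_zpow h]
  exact (zpow_le_zpow_iff_right₀ one_lt_p).symm

lemma sup3_eq {x ξ η : ℚ_[p]} (h1 : ξ ≠ x) (h2 : η ≠ x) (h3 : η ≠ ξ) :
    sup3Idx x ξ η = max (supIdx x ξ) (supIdx x η) := by
  unfold sup3Idx
  have : supIdx ξ η ≤ max (supIdx x ξ) (supIdx x η) := by
    rw [supIdx_le_iff h3.symm]
    refine (dist_triangle_max ξ x η).trans ?_
    rw [dist_comm ξ x]
    refine max_le ?_ ?_
    · rw [← supIdx_le_iff h1.symm]; exact le_max_left _ _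
    · rw [← supIdx_le_iff h2.symm]; exact le_max_right _ _
  omega

variable [MeasurableSpace ℚ_[p]] [BorelSpace ℚ_[p]] (μ : Measure ℚ_[p]) [μ.IsAddHaarMeasure]

lemma ball_union (k : ℤ) : closedBall (0 : ℚ_[p]) ((p : ℝ) ^ (k + 1)) =
    ⋃ i ∈ Finset.range p, closedBall ((i : ℚ_[p]) * (p : ℚ_[p]) ^ (-(k + 1))) ((p : ℝ) ^ k) := by
  have hp0 : (p : ℚ_[p]) ≠ 0 := by exact_mod_cast hp.out.ne_zero
  have hpp : (0 : ℝ) < p := p_pos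
  ext y
  simp only [Set.mem_iUnion, mem_closedBall, Finset.mem_range, exists_prop, dist_eq_norm, sub_zero]
  have key : ∀ z : ℚ_[p], ‖y - z * (p : ℚ_[p]) ^ (-(k + 1))‖ =
      ‖y * (p : ℚ_[p]) ^ (k + 1) - z‖ * (p : ℝ) ^ (k + 1) := by
    intro z
    have : y - z * (p : ℚ_[p]) ^ (-(k + 1)) =
        (y * (p : ℚ_[p]) ^ (k + 1) - z) * (p : ℚ_[p]) ^ (-(k + 1)) := by
      rw [sub_mul, mul_assoc, ← zpow_add₀ hp0]; simp
    rw [this, norm_mul, Padic.norm_p_zpow]; simp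
  constructor
  · intro hy
    have h1 : ‖y * (p : ℚ_[p]) ^ (k + 1)‖ ≤ 1 := by
      rw [norm_mul, Padic.norm_p_zpow, zpow_neg]
      exact mul_inv_le_one_of_le₀ hy (by positivity)
    obtain ⟨m, hm, hm2⟩ := PadicInt.exists_mem_range (p := p) ⟨_, h1⟩
    refine ⟨m, hm, ?_⟩
    rw [key]
    rw [IsLocalRing.mem_maximalIdeal, PadicInt.mem_nonunits, PadicInt.norm_def] at hm2
    change ‖y * (p : ℚ_[p]) ^ (k + 1) - (((m : ℤ_[p])) : ℚ_[p])‖ < 1 at hm2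
    rw [PadicInt.coe_natCast] at hm2
    have h2 := (Padic.norm_le_pow_iff_norm_lt_pow_add_one (y * (p : ℚ_[p]) ^ (k + 1) - (m : ℚ_[p])) (-1)).2
      (by simpa using hm2)
    calc _ ≤ (p : ℝ) ^ (-1 : ℤ) * (p : ℝ) ^ (k + 1) := by gcongr
      _ = _ := by rw [← zpow_add₀ hpp.ne']; congr 1; ring
  · rintro ⟨i, -, hi⟩
    have : y = (y - i * (p : ℚ_[p]) ^ (-(k + 1))) + i * (p : ℚ_[p]) ^ (-(k + 1)) := by ring
    rw [this]
    refine (Padic.nonarchimedean _ _).trans (max_le (hi.trans ?_) ?_)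
    · exact zpow_le_zpow_right₀ one_lt_p.le (by omega)
    · rw [norm_mul, Padic.norm_p_zpow, neg_neg]
      have : ‖(i : ℚ_[p])‖ ≤ 1 := by simpa using Padic.norm_int_le_one (p := p) (i : ℤ)
      exact mul_le_of_le_one_left (by positivity) this

lemma measure_step (k : ℤ) : μ (closedBall (0 : ℚ_[p]) ((p : ℝ) ^ (k + 1))) =
    p * μ (closedBall (0 : ℚ_[p]) ((p : ℝ) ^ k)) := by
  have hpp : (0 : ℝ) < p := p_pos
  rw [ball_union, measure_biUnion_finset]
  · simp [Measure.addHaar_closedBall_center]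
  · intro i hi j hj hij
    refine Set.disjoint_left.2 fun y hy1 hy2 => hij ?_
    simp only [mem_closedBall] at hy1 hy2
    have h := (dist_triangle_max _ y _).trans (max_le (dist_comm y _ ▸ hy1) hy2)
    rw [dist_eq_norm, ← sub_mul, norm_mul, Padic.norm_p_zpow, neg_neg] at h
    have h2 : ‖((i : ℤ) - (j : ℤ) : ℤ) - (0 : ℚ_[p])‖ < 1 := by
      push_cast
      rw [sub_zero]
      by_contra hc
      push Not at hc
      have : (p : ℝ) ^ k < (p : ℝ) ^ (k + 1) := zpow_lt_zpow_right₀ one_lt_p (by omega)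
      have h3 : (0 : ℝ) < (p : ℝ) ^ (k + 1) := by positivity
      nlinarith
    rw [sub_zero, Padic.norm_intCast_lt_one_iff] at h2
    simp at hi hj
    have := Int.eq_zero_of_abs_lt_dvd h2 (by rw [abs_lt]; omega)
    omega
  · intro i _; exact isClosed_closedBall.measurableSet

variable {μ}

lemma measure_ball (hμ : μ (closedBall 0 1) = 1) (x : ℚ_[p]) (k : ℤ) :
    μ.real (closedBall x ((p : ℝ) ^ k)) = (p : ℝ) ^ k := by
  have hpp : (0 : ℝ) < p := p_pos
  have hs : ∀ k : ℤ, μ.real (closedBall (0 : ℚ_[p]) ((p : ℝ) ^ (k + 1))) =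
      p * μ.real (closedBall (0 : ℚ_[p]) ((p : ℝ) ^ k)) := by
    intro k; simp [Measure.real, measure_step]
  have : μ.real (closedBall x ((p : ℝ) ^ k)) = μ.real (closedBall (0 : ℚ_[p]) ((p : ℝ) ^ k)) := by
    rw [Measure.real, Measure.addHaar_closedBall_center, Measure.real]
  rw [this]
  induction k using Int.induction_on with
  | zero => simp [Measure.real, hμ]
  | succ i ih => rw [hs, ih (by rw [Measure.real, Measure.addHaar_closedBall_center, Measure.real]), zpow_add_one₀ hpp.ne', mul_comm]
  | pred i ih =>
    have h := ih (by rw [Measure.real, Measure.addHaar_closedBall_center, Measure.real])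
    have h2 := hs (-i - 1)
    rw [sub_add_cancel, h] at h2
    have h3 : (p : ℝ) ^ (-(i : ℤ)) = p * (p : ℝ) ^ (-(i : ℤ) - 1) := by
      rw [zpow_sub_one₀ hpp.ne']; field_simp
    rw [h3] at h2
    exact (mul_left_cancel₀ hpp.ne' h2).symm

lemma ball_lt_top (x : ℚ_[p]) (r : ℝ) : μ (closedBall x r) < ⊤ :=
  (isCompact_closedBall x r).measure_lt_top

/-- The sphere of radius `p ^ k`. -/
def sph (x : ℚ_[p]) (k : ℤ) : Set ℚ_[p] :=
  closedBall x ((p : ℝ) ^ k) \ closedBall x ((p : ℝ) ^ (k - 1))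

lemma mem_sph {x y : ℚ_[p]} {k : ℤ} : y ∈ sph x k ↔ y ≠ x ∧ supIdx x y = k := by
  by_cases h : y = x
  · subst h
    simp [sph, (zpow_pos (p_pos (p := p)) _).le]
  · have h' : x ≠ y := Ne.symm h
    rw [sph, Set.mem_sdiff, mem_closedBall, mem_closedBall, dist_comm, ← supIdx_le_iff h',
      ← supIdx_le_iff h']
    simp only [ne_eq, h, not_false_eq_true, true_and]
    omega

lemma meas_sph (x : ℚ_[p]) (k : ℤ) : MeasurableSet (sph x k) :=
  isClosed_closedBall.measurableSet.diff isClosed_closedBall.measurableSet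

lemma ball_mono (x : ℚ_[p]) {j k : ℤ} (h : j ≤ k) :
    closedBall x ((p : ℝ) ^ j) ⊆ closedBall x ((p : ℝ) ^ k) :=
  closedBall_subset_closedBall (zpow_le_zpow_right₀ one_lt_p.le h)

lemma measure_sph (hμ : μ (closedBall 0 1) = 1) (x : ℚ_[p]) (k : ℤ) :
    μ.real (sph x k) = (p : ℝ) ^ k - (p : ℝ) ^ (k - 1) := by
  rw [sph, measureReal_sdiff (ball_mono x (by omega)) isClosed_closedBall.measurableSet
    (ball_lt_top _ _).ne, measure_ball hμ, measure_ball hμ]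

lemma sph_lt_top (x : ℚ_[p]) (k : ℤ) : μ (sph x k) < ⊤ :=
  (measure_mono Set.sdiff_subset).trans_lt (ball_lt_top (μ := μ) x _)

lemma integral_sph (hμ : μ (closedBall 0 1) = 1) (T : ℤ → ℂ) (x : ℚ_[p]) (k : ℤ) :
    IntegrableOn (fun ξ => T (supIdx x ξ)) (sph x k) μ ∧
    ∫ ξ in sph x k, T (supIdx x ξ) ∂μ = T k * (((p : ℝ) ^ k - (p : ℝ) ^ (k - 1) : ℝ) : ℂ) := by
  have h : Set.EqOn (fun ξ => T (supIdx x ξ)) (fun _ => T k) (sph x k) := by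
    intro ξ hξ
    simp [(mem_sph.1 hξ).2]
  constructor
  · rw [integrableOn_congr_fun h (meas_sph x k)]
    exact integrableOn_const (sph_lt_top x k).ne
  · rw [setIntegral_congr_fun (meas_sph x k) h, setIntegral_const, measure_sph hμ,
      Complex.real_smul, mul_comm]

lemma ae_ne (x : ℚ_[p]) : ∀ᵐ ξ ∂μ, ξ ≠ x := by
  have : μ {x} = 0 := measure_singleton x
  exact measure_eq_zero_iff_ae_notMem.1 this

lemma integral_ball (hμ : μ (closedBall 0 1) = 1) (h : ℤ → ℂ) (x : ℚ_[p]) (j : ℤ) (n : ℕ) :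
    IntegrableOn (fun ξ => h (max (supIdx x ξ) j)) (closedBall x ((p : ℝ) ^ (j + n))) μ ∧
    ∫ ξ in closedBall x ((p : ℝ) ^ (j + n)), h (max (supIdx x ξ) j) ∂μ =
      h j * (((p : ℝ) ^ j : ℝ) : ℂ) + ∑ k ∈ Finset.range n,
        h (j + 1 + k) * (((p : ℝ) ^ (j + 1 + (k : ℤ)) - (p : ℝ) ^ (j + (k : ℤ)) : ℝ) : ℂ) := by
  induction n with
  | zero =>
    have hc : (fun ξ => h (max (supIdx x ξ) j)) =ᵐ[μ.restrict (closedBall x ((p : ℝ) ^ j))]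
        fun _ => h j := by
      rw [Filter.EventuallyEq, ae_restrict_iff' isClosed_closedBall.measurableSet]
      filter_upwards [ae_ne (μ := μ) x] with ξ h1 h2
      rw [mem_closedBall, dist_comm, ← supIdx_le_iff h1.symm] at h2
      rw [max_eq_right h2]
    simp only [Nat.cast_zero, add_zero, Finset.range_zero, Finset.sum_empty]
    constructor
    · rw [IntegrableOn, integrable_congr hc]
      exact integrableOn_const (ball_lt_top _ _).ne
    · rw [integral_congr_ae hc, setIntegral_const, measure_ball hμ, Complex.real_smul, mul_comm]
  | succ n ih =>
    have hu : closedBall x ((p : ℝ) ^ (j + (n + 1 : ℕ))) =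
        closedBall x ((p : ℝ) ^ (j + n)) ∪ sph x (j + 1 + n) := by
      have e1 : j + 1 + (n : ℤ) - 1 = j + n := by ring
      have e2 : j + ((n + 1 : ℕ) : ℤ) = j + 1 + n := by push_cast; ring
      rw [sph, e1, e2, Set.union_sdiff_self, Set.union_eq_self_of_subset_left]
      exact ball_mono x (by omega)
    have hd : Disjoint (closedBall x ((p : ℝ) ^ (j + n))) (sph x (j + 1 + n)) := by
      have e1 : j + 1 + (n : ℤ) - 1 = j + n := by ring
      rw [sph, e1]; exact Set.disjoint_sdiff_right
    obtain ⟨h1, h2⟩ := integral_sph hμ (fun s => h (max s j)) x (j + 1 + n)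
    rw [hu]
    refine ⟨ih.1.union h1, ?_⟩
    rw [setIntegral_union hd (meas_sph _ _) ih.1 h1, ih.2, h2, Finset.sum_range_succ,
      max_eq_left (by omega)]
    have e1 : j + 1 + (n : ℤ) - 1 = j + n := by ring
    rw [e1, add_assoc]

section wavelet

variable {ψ : ℚ_[p] → ℂ} {c : ℚ_[p]} {γ : ℤ}

lemma wav_integrable (hψ : IsWavelet μ ψ c γ) : Integrable ψ μ := by
  obtain ⟨h1, h2, -, -⟩ := hψ
  have hc : Continuous ψ := by
    rw [Metric.continuous_iff]
    intro b ε hε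
    refine ⟨(p : ℝ) ^ (γ - 1), zpow_pos p_pos _, fun a ha => ?_⟩
    rw [h2 a b ha.le, dist_self]
    exact hε
  refine hc.integrable_of_hasCompactSupport (HasCompactSupport.intro
    (isCompact_closedBall c ((p : ℝ) ^ γ)) fun x hx => h1 x ?_)
  simpa using hx

lemma wav_setIntegral (hψ : IsWavelet μ ψ c γ) {x : ℚ_[p]} (hx : dist x c ≤ (p : ℝ) ^ γ) :
    ∫ ξ in closedBall x ((p : ℝ) ^ γ), ψ ξ ∂μ = 0 := by
  rw [setIntegral_eq_integral_of_forall_compl_eq_zero, hψ.2.2.1]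
  intro y hy
  apply hψ.1
  by_contra hc
  push Not at hc
  apply hy
  rw [mem_closedBall]
  exact (dist_triangle_max y c x).trans (max_le hc (dist_comm x c ▸ hx))

lemma wav_out (hψ : IsWavelet μ ψ c γ) {x : ℚ_[p]} (hx : (p : ℝ) ^ γ < dist x c)
    (h : ℤ → ℂ) (ξ : ℚ_[p]) : h (supIdx x ξ) * ψ ξ = h (supIdx x c) * ψ ξ := by
  by_cases hξ : (p : ℝ) ^ γ < dist ξ c
  · rw [hψ.1 ξ hξ]; simp
  · push Not at hξ
    have hd : dist x ξ = dist x c := by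
      apply le_antisymm
      · exact (dist_triangle_max x c ξ).trans (max_le le_rfl (dist_comm ξ c ▸ hξ.trans hx.le))
      · rcases le_max_iff.1 (dist_triangle_max x ξ c) with h | h
        · exact h
        · exact absurd (h.trans hξ) (not_le.2 hx)
    have hxc : x ≠ c := by
      rintro rfl
      rw [dist_self] at hx
      exact absurd hx (not_lt.2 (zpow_pos p_pos _).le)
    have hxξ : x ≠ ξ := by
      intro h
      rw [h, dist_self, ← h] at hd
      exact hxc (dist_eq_zero.1 hd.symm)
    rw [dist_eq_zpow hxc, dist_eq_zpow hxξ] at hd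
    rw [zpow_right_injective₀ p_pos one_lt_p.ne' hd]

/-- Wavelets diagonalise radial kernels. -/
lemma eig (hμ : μ (closedBall 0 1) = 1) (hψ : IsWavelet μ ψ c γ) (T : ℤ → ℂ) (x : ℚ_[p])
    (hT : Summable (fun n : ℕ => ‖T (γ + 1 + n)‖ *
      ((p : ℝ) ^ (γ + 1 + (n : ℤ)) - (p : ℝ) ^ (γ + (n : ℤ))))) :
    Integrable (fun ξ => T (supIdx x ξ) * (ψ x - ψ ξ)) μ ∧
    ∫ ξ, T (supIdx x ξ) * (ψ x - ψ ξ) ∂μ = ψ x * lamBall (fun _ => T) x γ := by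
  have hi := wav_integrable hψ
  by_cases hx : (p : ℝ) ^ γ < dist x c
  · have e : (fun ξ => T (supIdx x ξ) * (ψ x - ψ ξ)) = fun ξ => -(T (supIdx x c) * ψ ξ) := by
      funext ξ
      rw [← wav_out hψ hx T, hψ.1 x hx]; ring
    rw [e]
    refine ⟨(hi.const_mul _).neg, ?_⟩
    rw [integral_neg, integral_const_mul, hψ.2.2.1, hψ.1 x hx]; simp
  push Not at hx
  have hB : MeasurableSet (closedBall x ((p : ℝ) ^ γ)) := isClosed_closedBall.measurableSet
  have e1 : Set.EqOn (fun ξ => T (supIdx x ξ) * (ψ x - ψ ξ)) (fun ξ => T γ * (ψ x - ψ ξ))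
      (closedBall x ((p : ℝ) ^ γ)) := by
    intro ξ hξ
    by_cases h : ξ ∈ closedBall x ((p : ℝ) ^ (γ - 1))
    · have := hψ.2.1 ξ x (mem_closedBall.1 h)
      simp [this]
    · have : ξ ∈ sph x γ := ⟨hξ, h⟩
      simp [(mem_sph.1 this).2]
  have e2 : Set.EqOn (fun ξ => T (supIdx x ξ) * (ψ x - ψ ξ)) (fun ξ => T (supIdx x ξ) * ψ x)
      (closedBall x ((p : ℝ) ^ γ))ᶜ := by
    intro ξ hξ
    have : ψ ξ = 0 := by
      apply hψ.1
      by_contra hc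
      push Not at hc
      exact hξ (mem_closedBall.2
        ((dist_triangle_max ξ c x).trans (max_le hc (dist_comm x c ▸ hx))))
    simp [this]
  have hcu : (closedBall x ((p : ℝ) ^ γ))ᶜ = ⋃ n : ℕ, sph x (γ + 1 + n) := by
    ext ξ
    simp only [Set.mem_iUnion, mem_sph, Set.mem_compl_iff]
    by_cases h : ξ = x
    · subst h
      simp [(zpow_pos (p_pos (p := p)) _).le]
    · rw [mem_closedBall, dist_comm, ← supIdx_le_iff (Ne.symm h)]
      simp only [ne_eq, h, not_false_eq_true, true_and]
      constructor
      · intro h; exact ⟨(supIdx x ξ - γ - 1).toNat, by omega⟩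
      · rintro ⟨n, hn⟩; omega
  have e3 : ∀ n : ℕ, γ + 1 + (n : ℤ) - 1 = γ + n := fun n => by ring
  have hTi : IntegrableOn (fun ξ => T (supIdx x ξ)) (⋃ n : ℕ, sph x (γ + 1 + n)) μ := by
    refine integrableOn_iUnion_of_summable_integral_norm
      (fun n => (integral_sph hμ T x _).1) (hT.congr fun n => ?_)
    have h := (integral_sph hμ (fun s => (‖T s‖ : ℂ)) x (γ + 1 + n)).2
    rw [integral_complex_ofReal, e3] at h
    exact_mod_cast h.symm
  have hd : Pairwise (Function.onFun Disjoint fun n : ℕ => sph x (γ + 1 + n)) := by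
    intro m n hmn
    refine Set.disjoint_left.2 fun y h1 h2 => hmn ?_
    have := (mem_sph.1 h1).2
    have := (mem_sph.1 h2).2
    omega
  have hI1 : IntegrableOn (fun ξ => T (supIdx x ξ) * (ψ x - ψ ξ))
      (closedBall x ((p : ℝ) ^ γ)) μ := by
    rw [integrableOn_congr_fun e1 hB]
    exact ((integrableOn_const (ball_lt_top _ _).ne).sub hi.integrableOn).const_mul _
  have hI2 : IntegrableOn (fun ξ => T (supIdx x ξ) * (ψ x - ψ ξ))
      (closedBall x ((p : ℝ) ^ γ))ᶜ μ := by
    rw [integrableOn_congr_fun e2 hB.compl, hcu]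
    exact hTi.mul_const _
  have hI : Integrable (fun ξ => T (supIdx x ξ) * (ψ x - ψ ξ)) μ := by
    rw [← integrableOn_univ, ← Set.union_compl_self (closedBall x ((p : ℝ) ^ γ))]
    exact hI1.union hI2
  refine ⟨hI, ?_⟩
  have : IsFiniteMeasure (μ.restrict (closedBall x ((p : ℝ) ^ γ))) :=
    ⟨by simpa using ball_lt_top x _⟩
  rw [← integral_add_compl hB hI, setIntegral_congr_fun hB e1, setIntegral_congr_fun hB.compl e2,
    integral_const_mul, integral_mul_const,
    integral_sub (integrable_const _) hi.integrableOn,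
    wav_setIntegral hψ hx, setIntegral_const, measure_ball hμ, hcu,
    integral_iUnion (fun n => meas_sph _ _) hd hTi, lamBall]
  simp_rw [(integral_sph hμ T x _).2, e3]
  rw [Complex.real_smul]
  ring

/-- Integral of a wavelet against a radial function constant at small scales. -/
lemma rad (hμ : μ (closedBall 0 1) = 1) (hψ : IsWavelet μ ψ c γ) (h : ℤ → ℂ) (x : ℚ_[p])
    (j : ℤ) :
    Integrable (fun ξ => h (max (supIdx x ξ) j) * ψ ξ) μ ∧
    (γ ≤ j → ∫ ξ, h (max (supIdx x ξ) j) * ψ ξ ∂μ = 0) ∧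
    (∀ n : ℕ, γ = j + n + 1 → ∫ ξ, h (max (supIdx x ξ) j) * ψ ξ ∂μ = ψ x *
      ((h j - h γ) * (((p : ℝ) ^ j : ℝ) : ℂ) + ∑ k ∈ Finset.range n,
        (h (j + 1 + k) - h γ) *
          (((p : ℝ) ^ (j + 1 + (k : ℤ)) - (p : ℝ) ^ (j + (k : ℤ)) : ℝ) : ℂ))) := by
  have hi := wav_integrable hψ
  by_cases hx : (p : ℝ) ^ γ < dist x c
  · have e : (fun ξ => h (max (supIdx x ξ) j) * ψ ξ) = fun ξ => h (max (supIdx x c) j) * ψ ξ := by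
      funext ξ
      exact wav_out hψ hx (fun s => h (max s j)) ξ
    rw [e, integral_const_mul, hψ.2.2.1, hψ.1 x hx]
    exact ⟨hi.const_mul _, by simp, by simp⟩
  push Not at hx
  have hout : ∀ ξ, ξ ∉ closedBall x ((p : ℝ) ^ γ) → ψ ξ = 0 := by
    intro ξ hξ
    apply hψ.1
    by_contra hc
    push Not at hc
    exact hξ (mem_closedBall.2
      ((dist_triangle_max ξ c x).trans (max_le hc (dist_comm x c ▸ hx))))
  by_cases hj : γ ≤ j
  · have e : (fun ξ => h (max (supIdx x ξ) j) * ψ ξ) =ᵐ[μ] fun ξ => h j * ψ ξ := by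
      filter_upwards [ae_ne (μ := μ) x] with ξ h1
      by_cases h2 : ξ ∈ closedBall x ((p : ℝ) ^ γ)
      · rw [mem_closedBall, dist_comm, ← supIdx_le_iff h1.symm] at h2
        rw [max_eq_right (h2.trans hj)]
      · rw [hout ξ h2]; simp
    rw [integrable_congr e, integral_congr_ae e, integral_const_mul, hψ.2.2.1]
    exact ⟨hi.const_mul _, by simp, fun n hn => by omega⟩
  push Not at hj
  obtain ⟨n, hn⟩ : ∃ n : ℕ, γ = j + n + 1 := ⟨(γ - j - 1).toNat, by omega⟩
  have hγ : j + (n : ℤ) = γ - 1 := by omega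
  obtain ⟨hb1, hb2⟩ := integral_ball hμ (fun s => h s - h γ) x j n
  rw [hγ] at hb1 hb2
  have hB : MeasurableSet (closedBall x ((p : ℝ) ^ (γ - 1))) := isClosed_closedBall.measurableSet
  have e : (fun ξ => h (max (supIdx x ξ) j) * ψ ξ) = fun ξ => h γ * ψ ξ +
      ψ x * (closedBall x ((p : ℝ) ^ (γ - 1))).indicator
        (fun ξ => h (max (supIdx x ξ) j) - h γ) ξ := by
    funext ξ
    by_cases h1 : ξ ∈ closedBall x ((p : ℝ) ^ (γ - 1))
    · rw [Set.indicator_of_mem h1, hψ.2.1 ξ x (mem_closedBall.1 h1)]; ring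
    · rw [Set.indicator_of_notMem h1]
      by_cases h2 : ξ ∈ closedBall x ((p : ℝ) ^ γ)
      · have : ξ ∈ sph x γ := ⟨h2, h1⟩
        rw [(mem_sph.1 this).2, max_eq_left hj.le]; ring
      · rw [hout ξ h2]; simp
  have hA : Integrable (fun ξ => ψ x * (closedBall x ((p : ℝ) ^ (γ - 1))).indicator
        (fun ξ => h (max (supIdx x ξ) j) - h γ) ξ) μ :=
    (hb1.integrable_indicator hB).const_mul _
  rw [e]
  refine ⟨(hi.const_mul _).add hA, fun h => by omega, fun m hm => ?_⟩
  obtain rfl : m = n := by omega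
  rw [integral_add (hi.const_mul _) hA, integral_const_mul, integral_const_mul, hψ.2.2.1,
    integral_indicator hB, hb2]
  simp

end wavelet

section algebra

/-- Summability of a radial kernel. -/
def RadSum (p : ℕ) (T : ℤ → ℂ) : Prop :=
  ∀ γ₀ : ℤ, Summable (fun n : ℕ =>
    ‖T (γ₀ + 1 + n)‖ * ((p : ℝ) ^ (γ₀ + 1 + (n : ℤ)) - (p : ℝ) ^ (γ₀ + (n : ℤ))))

lemma RadSum.summable {T : ℤ → ℂ} (hT : RadSum p T) (γ₀ : ℤ) : Summable (fun n : ℕ =>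
    T (γ₀ + 1 + n) * (((p : ℝ) ^ (γ₀ + 1 + (n : ℤ)) - (p : ℝ) ^ (γ₀ + (n : ℤ)) : ℝ) : ℂ)) := by
  refine Summable.of_norm ((hT γ₀).congr fun n => ?_)
  rw [norm_mul, Complex.norm_real, Real.norm_of_nonneg]
  exact sub_nonneg.2 (zpow_le_zpow_right₀ one_lt_p.le (by omega))

lemma RadSum.max {T : ℤ → ℂ} (hT : RadSum p T) (s : ℤ) : RadSum p (fun m => T (max s m)) := by
  intro γ₀
  rw [← summable_nat_add_iff (s - γ₀).toNat]
  refine ((summable_nat_add_iff (s - γ₀).toNat).2 (hT γ₀)).congr fun n => ?_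
  dsimp only
  rw [max_eq_right]
  push_cast
  omega

lemma lam_step {T : ℤ → ℂ} (hT : RadSum p T) (x : ℚ_[p]) (s : ℤ) :
    lamBall (fun _ => T) x s = lamBall (fun _ => T) x (s + 1) +
      (T s - T (s + 1)) * (((p : ℝ) ^ s : ℝ) : ℂ) := by
  unfold lamBall
  rw [(hT.summable s).tsum_eq_zero_add]
  have : ∀ n : ℕ, s + 1 + ((n + 1 : ℕ) : ℤ) = s + 1 + 1 + n := fun n => by push_cast; ring
  have h2 : ∀ n : ℕ, s + ((n + 1 : ℕ) : ℤ) = s + 1 + n := fun n => by push_cast; ring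
  simp_rw [this, h2]
  push_cast
  simp only [add_zero]
  ring

lemma lam_max {T : ℤ → ℂ} (hT : RadSum p T) (x : ℚ_[p]) (s γ : ℤ) :
    lamBall (fun _ => fun m => T (max s m)) x γ = lamBall (fun _ => T) x (max s γ) := by
  have base : ∀ γ, s ≤ γ →
      lamBall (fun _ => fun m => T (max s m)) x γ = lamBall (fun _ => T) x γ := by
    intro γ h
    unfold lamBall
    dsimp only
    rw [max_eq_right h]
    congr 1
    refine tsum_congr fun n => ?_
    rw [max_eq_right (by omega)]
  have down : ∀ n : ℕ, lamBall (fun _ => fun m => T (max s m)) x (s - n) =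
      lamBall (fun _ => T) x s := by
    intro n
    induction n with
    | zero => simpa using base s le_rfl
    | succ n ih =>
      rw [lam_step (hT.max s)]
      have : s - ((n + 1 : ℕ) : ℤ) + 1 = s - n := by push_cast; ring
      rw [this, ih, max_eq_left (by omega), max_eq_left (by omega)]
      ring
  rcases le_total s γ with h | h
  · rw [max_eq_right h, base γ h]
  · rw [max_eq_left h, ← down (s - γ).toNat]
    congr 1
    omega

lemma tele (j : ℤ) (n : ℕ) : (((p : ℝ) ^ j : ℝ) : ℂ) + ∑ k ∈ Finset.range n,
    (((p : ℝ) ^ (j + 1 + (k : ℤ)) - (p : ℝ) ^ (j + (k : ℤ)) : ℝ) : ℂ) =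
    (((p : ℝ) ^ (j + n) : ℝ) : ℂ) := by
  induction n with
  | zero => simp
  | succ n ih =>
    rw [Finset.sum_range_succ, ← add_assoc, ih]
    have : j + ((n + 1 : ℕ) : ℤ) = j + 1 + n := by push_cast; ring
    rw [this]
    push_cast
    ring

lemma phi_eq {T : ℤ → ℂ} (hT : RadSum p T) (x : ℚ_[p]) (j : ℤ) (n : ℕ) :
    (lamBall (fun _ => T) x j - lamBall (fun _ => T) x (j + n + 1)) * (((p : ℝ) ^ j : ℝ) : ℂ) +
      ∑ k ∈ Finset.range n,
        (lamBall (fun _ => T) x (j + 1 + k) - lamBall (fun _ => T) x (j + n + 1)) *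
          (((p : ℝ) ^ (j + 1 + (k : ℤ)) - (p : ℝ) ^ (j + (k : ℤ)) : ℝ) : ℂ) =
    - PhiIJ (fun _ => T) x (j + n + 1) j := by
  have hpp : (0 : ℝ) < p := p_pos
  have sq : ∀ m : ℤ, (((p : ℝ) ^ (2 * m) : ℝ) : ℂ) =
      (((p : ℝ) ^ m : ℝ) : ℂ) * (((p : ℝ) ^ m : ℝ) : ℂ) := by
    intro m; rw [← Complex.ofReal_mul, ← zpow_add₀ hpp.ne']; congr 2; ring
  induction n with
  | zero =>
    have : Finset.Ioo j (j + 1) = ∅ := by ext; simp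
    simp only [Nat.cast_zero, add_zero, Finset.range_zero, Finset.sum_empty, PhiIJ, this]
    rw [lam_step hT x j, add_sub_cancel_right, sq]
    ring
  | succ n ih =>
    have e : j + ((n + 1 : ℕ) : ℤ) + 1 = (j + n + 1) + 1 := by push_cast; ring
    have e' : j + 1 + (n : ℤ) = j + n + 1 := by ring
    have hIoo : Finset.Ioo j (j + n + 1 + 1) = insert (j + n + 1) (Finset.Ioo j (j + n + 1)) := by
      ext m; simp only [Finset.mem_Ioo, Finset.mem_insert]; omega
    set L := fun s => lamBall (fun _ : ℚ_[p] => T) x s with hL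
    have hstep := lam_step hT x (j + n + 1)
    have htel := tele (p := p) j (n + 1)
    have hphi : PhiIJ (fun _ => T) x (j + n + 1 + 1) j = PhiIJ (fun _ => T) x (j + n + 1) j +
        (((p : ℝ) ^ (2 * (j + n + 1)) : ℝ) : ℂ) * (T (j + n + 1 + 1) - T (j + n + 1)) := by
      unfold PhiIJ
      rw [hIoo, Finset.sum_insert (by simp), add_sub_cancel_right]
      have : 2 * (j + (n : ℤ) + 1) - 2 = 2 * (j + n + 1 - 1) := by ring
      rw [this]
      push_cast
      ring
    rw [e, hphi]
    have hsum : ∀ a : ℂ, ∑ k ∈ Finset.range (n + 1), (L (j + 1 + k) - a) *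
          (((p : ℝ) ^ (j + 1 + (k : ℤ)) - (p : ℝ) ^ (j + (k : ℤ)) : ℝ) : ℂ) =
        ∑ k ∈ Finset.range (n + 1), (L (j + 1 + k) - L (j + n + 1)) *
          (((p : ℝ) ^ (j + 1 + (k : ℤ)) - (p : ℝ) ^ (j + (k : ℤ)) : ℝ) : ℂ) +
        (L (j + n + 1) - a) * ∑ k ∈ Finset.range (n + 1),
          (((p : ℝ) ^ (j + 1 + (k : ℤ)) - (p : ℝ) ^ (j + (k : ℤ)) : ℝ) : ℂ) := by
      intro a
      rw [Finset.mul_sum, ← Finset.sum_add_distrib]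
      refine Finset.sum_congr rfl fun k _ => ?_
      ring
    have h1 := hsum (L (j + n + 1 + 1))
    rw [Finset.sum_range_succ (fun k : ℕ => (L (j + 1 + k) - L (j + n + 1)) *
          (((p : ℝ) ^ (j + 1 + (k : ℤ)) - (p : ℝ) ^ (j + (k : ℤ)) : ℝ) : ℂ)), e', sub_self,
          zero_mul, add_zero] at h1
    have e2 : j + ((n + 1 : ℕ) : ℤ) = j + n + 1 := by push_cast; ring
    rw [e2] at htel
    rw [← eq_sub_iff_add_eq'] at htel
    rw [htel] at h1
    simp only [hL] at h1
    rw [h1, sq]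
    linear_combination ih + (((p : ℝ) ^ (j + n + 1) : ℝ) : ℂ) * hstep

end algebra

lemma ball_ssubset_iff {x a b : ℚ_[p]} {j k : ℤ} (ha : dist x a ≤ (p : ℝ) ^ j) :
    closedBall a ((p : ℝ) ^ j) ⊂ closedBall b ((p : ℝ) ^ k) ↔
      j < k ∧ dist x b ≤ (p : ℝ) ^ k := by
  have e : closedBall a ((p : ℝ) ^ j) = closedBall x ((p : ℝ) ^ j) :=
    (IsUltrametricDist.closedBall_eq_of_mem (mem_closedBall.2 ha))
  rw [e]
  constructor
  · intro h
    have hb : dist x b ≤ (p : ℝ) ^ k :=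
      mem_closedBall.1 (h.1 (mem_closedBall_self (zpow_pos p_pos _).le))
    refine ⟨?_, hb⟩
    by_contra hc
    rw [IsUltrametricDist.closedBall_eq_of_mem (mem_closedBall.2 hb)] at h
    exact h.2 (ball_mono x (not_lt.1 hc))
  · rintro ⟨h1, hb⟩
    rw [IsUltrametricDist.closedBall_eq_of_mem (mem_closedBall.2 hb)]
    refine ⟨ball_mono x h1.le, fun h => ?_⟩
    have hm : x + (p : ℚ_[p]) ^ (-k) ∈ closedBall x ((p : ℝ) ^ k) := by
      rw [mem_closedBall, dist_eq_norm]; simp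
    have := h hm
    rw [mem_closedBall, dist_eq_norm, add_sub_cancel_left, Padic.norm_p_zpow, neg_neg] at this
    exact absurd this (not_le.2 (zpow_lt_zpow_right₀ one_lt_p h1))

/-- The cascade operator on a finite combination of wavelets. -/
lemma op_eq (hμ : μ (closedBall 0 1) = 1) (F G : ℚ_[p] → ℤ → ℂ)
    (hFs : KernelSummable F) (hGs : KernelSummable G)
    (n : ℕ) (ψ : Fin n → ℚ_[p] → ℂ) (c : Fin n → ℚ_[p]) (γ : Fin n → ℤ)
    (hψ : ∀ k, IsWavelet μ (ψ k) (c k) (γ k)) (a : Fin n → ℂ) (x : ℚ_[p]) :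
    cascadeOp μ F G (fun y => ∑ k, a k * ψ k y) x =
      ∑ k, a k * ψ k x * (lamBall G x (γ k) +
        ∑ j, if γ k < γ j then a j * ψ j x * PhiIJ F x (γ j) (γ k) else 0) := by
  have hF : RadSum p (F x) := hFs x
  have hGG : ∫ ξ, G x (supIdx x ξ) * ((∑ k, a k * ψ k x) - ∑ k, a k * ψ k ξ) ∂μ =
      ∑ k, a k * ψ k x * lamBall G x (γ k) := by
    have e : (fun ξ => G x (supIdx x ξ) * ((∑ k, a k * ψ k x) - ∑ k, a k * ψ k ξ)) =
        fun ξ => ∑ k, a k * (G x (supIdx x ξ) * (ψ k x - ψ k ξ)) := by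
      funext ξ
      rw [← Finset.sum_sub_distrib, Finset.mul_sum]
      exact Finset.sum_congr rfl fun k _ => by ring
    rw [e, integral_finsetSum _ fun k _ => ((eig hμ (hψ k) (G x) x (hGs x (γ k))).1.const_mul _)]
    refine Finset.sum_congr rfl fun k _ => ?_
    rw [integral_const_mul, (eig hμ (hψ k) (G x) x (hGs x (γ k))).2, mul_assoc]
    rfl
  have hin : ∀ ξ, ξ ≠ x → ∫ η, F x (sup3Idx x ξ η) *
      ((∑ k, a k * ψ k ξ) * ((∑ k, a k * ψ k η) - ∑ k, a k * ψ k x)) ∂μ =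
      ∑ j, ∑ i, -(a j * ψ j x * a i) * (lamBall F x (max (supIdx x ξ) (γ j)) * ψ i ξ) := by
    intro ξ hξ
    have e : (fun η => F x (sup3Idx x ξ η) *
        ((∑ k, a k * ψ k ξ) * ((∑ k, a k * ψ k η) - ∑ k, a k * ψ k x))) =ᵐ[μ]
        fun η => ∑ j, (-(∑ k, a k * ψ k ξ) * a j) *
          (F x (max (supIdx x ξ) (supIdx x η)) * (ψ j x - ψ j η)) := by
      filter_upwards [ae_ne (μ := μ) x, ae_ne (μ := μ) ξ] with η h1 h2
      rw [sup3_eq hξ h1 h2, ← Finset.sum_sub_distrib, Finset.mul_sum, Finset.mul_sum]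
      exact Finset.sum_congr rfl fun k _ => by ring
    have hE := fun j => eig hμ (hψ j) (fun m => F x (max (supIdx x ξ) m)) x
      (hF.max (supIdx x ξ) (γ j))
    rw [integral_congr_ae e, integral_finsetSum _ fun j _ => ((hE j).1.const_mul _)]
    refine Finset.sum_congr rfl fun j _ => ?_
    rw [integral_const_mul, (hE j).2, lam_max hF x]
    rw [neg_mul, neg_mul, Finset.sum_mul, Finset.sum_mul, ← Finset.sum_neg_distrib]
    refine Finset.sum_congr rfl fun k _ => ?_
    change _ = -(a j * ψ j x * a k) * (lamBall (fun _ => F x) x _ * ψ k ξ)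
    ring
  have hR := fun i j => rad hμ (hψ i) (fun s => lamBall F x s) x (γ j)
  have hval : ∀ i j, ∫ ξ, lamBall F x (max (supIdx x ξ) (γ j)) * ψ i ξ ∂μ =
      if γ j < γ i then -(ψ i x * PhiIJ F x (γ i) (γ j)) else 0 := by
    intro i j
    split_ifs with h
    · obtain ⟨m, hm⟩ : ∃ m : ℕ, γ i = γ j + m + 1 := ⟨(γ i - γ j - 1).toNat, by omega⟩
      rw [(hR i j).2.2 m hm, hm, ← mul_neg]
      congr 1
      exact phi_eq hF x (γ j) m
    · exact (hR i j).2.1 (not_lt.1 h)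
  have hout : ∫ ξ, ∫ η, F x (sup3Idx x ξ η) *
      ((∑ k, a k * ψ k ξ) * ((∑ k, a k * ψ k η) - ∑ k, a k * ψ k x)) ∂μ ∂μ =
      ∑ k, a k * ψ k x *
        ∑ j, if γ k < γ j then a j * ψ j x * PhiIJ F x (γ j) (γ k) else 0 := by
    rw [integral_congr_ae ((ae_ne x).mono hin), integral_finsetSum _ fun j _ =>
      integrable_finsetSum _ fun i _ => ((hR i j).1.const_mul _)]
    refine Finset.sum_congr rfl fun j _ => ?_
    rw [integral_finsetSum _ fun i _ => ((hR i j).1.const_mul _), Finset.mul_sum]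
    refine Finset.sum_congr rfl fun i _ => ?_
    rw [integral_const_mul, hval]
    split_ifs
    · ring
    · simp
  rw [cascadeOp, hGG, hout, ← Finset.sum_add_distrib]
  exact Finset.sum_congr rfl fun k _ => by ring

end Cascade

/-- If `ψ 0, …, ψ (n-1)` are ultrametric wavelets with balls
`B k = B(c k, p^(γ k))`, and `cf 0, …, cf (n-1)` are `C¹` coefficient functions solving the
cascade system of ODEs
`cf k ' (t) = - cf k (t) [η_{B k} + Σ_{j : B k ⊊ B j} cf j (t) ψ j (c k) Φ_{B j, B k}]`
(the value `ψ j (c k)` does not depend on the choice of the point of `B k` since `ψ j` is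
constant on `B k ⊊ B j`; `Φ_{B j, B k}` is computed with the common center `c k ∈ B k ⊆ B j`),
then `v(x,t) = Σ_k cf k (t) ψ k (x)` satisfies the quadratic cascade equation. -/
theorem cascade_system_gives_solution {p : ℕ} [Fact p.Prime]
    [MeasurableSpace ℚ_[p]] [BorelSpace ℚ_[p]]
    (μ : Measure ℚ_[p]) [μ.IsAddHaarMeasure] (hμ : μ (Metric.closedBall 0 1) = 1)
    (F G : ℚ_[p] → ℤ → ℂ) (hF : IsBallKernel F) (hG : IsBallKernel G)
    (hFs : KernelSummable F) (hGs : KernelSummable G)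
    (n : ℕ) (ψ : Fin n → ℚ_[p] → ℂ) (c : Fin n → ℚ_[p]) (γ : Fin n → ℤ)
    (hψ : ∀ k, IsWavelet μ (ψ k) (c k) (γ k))
    (cf : Fin n → ℝ → ℂ)
    (hcfC : ∀ k, ContDiffOn ℝ 1 (cf k) (Set.Ici (0 : ℝ)))
    (hode : ∀ k, ∀ t : ℝ, 0 ≤ t →
      HasDerivWithinAt (cf k)
        (-(cf k t) * (lamBall G (c k) (γ k) +
          ∑ j ∈ Finset.univ.filter (fun j : Fin n =>
              Metric.closedBall (c k) ((p : ℝ) ^ (γ k)) ⊂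
                Metric.closedBall (c j) ((p : ℝ) ^ (γ j))),
            cf j t * ψ j (c k) * PhiIJ F (c k) (γ j) (γ k)))
        (Set.Ici (0 : ℝ)) t) :
    SatisfiesCascade μ F G (fun x t => ∑ k : Fin n, cf k t * ψ k x) := by
  intro x t ht
  have hd : HasDerivAt (fun s => ∑ k : Fin n, cf k s * ψ k x)
      (∑ k : Fin n, (-(cf k t) * (lamBall G (c k) (γ k) +
          ∑ j ∈ Finset.univ.filter (fun j : Fin n =>
              Metric.closedBall (c k) ((p : ℝ) ^ (γ k)) ⊂
                Metric.closedBall (c j) ((p : ℝ) ^ (γ j))),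
            cf j t * ψ j (c k) * PhiIJ F (c k) (γ j) (γ k))) * ψ k x) t :=
    HasDerivAt.fun_sum fun k _ =>
      ((hode k t ht.le).hasDerivAt (Ici_mem_nhds ht)).mul_const _
  refine hd.congr_deriv ?_
  rw [Cascade.op_eq hμ F G hFs hGs n ψ c γ hψ (fun k => cf k t) x, ← Finset.sum_neg_distrib]
  refine Finset.sum_congr rfl fun k _ => ?_
  by_cases hx : (p : ℝ) ^ γ k < dist x (c k)
  · rw [(hψ k).1 x hx]; simp
  push Not at hx
  have hle : ∀ m, γ k ≤ m → dist (c k) x ≤ (p : ℝ) ^ m := fun m hm =>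
    (dist_comm x (c k) ▸ hx).trans (zpow_le_zpow_right₀ Cascade.one_lt_p.le hm)
  have hl : lamBall G (c k) (γ k) = lamBall G x (γ k) := by
    unfold lamBall
    rw [hG _ _ _ (hle _ le_rfl)]
    congr 1
    exact tsum_congr fun m => by rw [hG _ _ _ (hle _ (by omega))]
  have hphi : ∀ j, γ k < γ j → PhiIJ F (c k) (γ j) (γ k) = PhiIJ F x (γ j) (γ k) := by
    intro j hj
    unfold PhiIJ
    rw [hF _ _ _ (hle _ le_rfl), hF _ _ _ (hle _ hj.le)]
    congr 1
    refine Finset.sum_congr rfl fun m hm => ?_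
    rw [hF _ _ _ (hle _ (Finset.mem_Ioo.1 hm).1.le)]
  have hs : (∑ j ∈ Finset.univ.filter (fun j : Fin n =>
              Metric.closedBall (c k) ((p : ℝ) ^ (γ k)) ⊂
                Metric.closedBall (c j) ((p : ℝ) ^ (γ j))),
            cf j t * ψ j (c k) * PhiIJ F (c k) (γ j) (γ k)) =
      ∑ j, if γ k < γ j then cf j t * ψ j x * PhiIJ F x (γ j) (γ k) else 0 := by
    rw [Finset.sum_filter]
    refine Finset.sum_congr rfl fun j _ => ?_
    rw [if_congr (Cascade.ball_ssubset_iff hx) rfl rfl]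
    by_cases h1 : γ k < γ j
    · rw [if_pos h1, hphi j h1, (hψ j).2.1 (c k) x (hle _ (by omega))]
      by_cases h2 : dist x (c j) ≤ (p : ℝ) ^ γ j
      · rw [if_pos ⟨h1, h2⟩]
      · rw [if_neg (fun h => h2 h.2), (hψ j).1 x (not_le.1 h2)]; simp
    · rw [if_neg h1, if_neg (fun h => h1 h.1)]
  rw [hl, hs]
  ring
end
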